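/- arXiv:2206.05524 — 2 statements merged into one kernel-verified Lean document; each statement's English description precedes it below -/
import Mathlib

section
/- Let K ≥ 1 and let a_k > 0 and θ_k > 0 for k = 1, …, K, and set A = Σ_{k=1}^K a_k. Then lim_{s → ∞} s^{A/2} · ∏_{k=1}^K γ(a_k, √(θ_k/s)) / Γ(a_k) = ∏_{k=1}^K θ_k^{a_k/2} / Γ(a_k + 1). -/
open MeasureTheory Real Filter

/-- The lower incomplete Gamma function `γ(a, x) = ∫₀^x t^(a−1) e^(−t) dt`. -/
noncomputable def lowerGamma (a x : ℝ) : ℝ :=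
  ∫ t in (0 : ℝ)..x, t ^ (a - 1) * Real.exp (-t)

theorem intervalIntegral_rpow_sub_one {a : ℝ} (ha : 0 < a) (x : ℝ) :
    ∫ t in (0 : ℝ)..x, t ^ (a - 1) = x ^ a / a := by
  rw [integral_rpow (Or.inl (by linarith)), sub_add_cancel, Real.zero_rpow ha.ne', sub_zero]

theorem intervalIntegrable_rpow_mul_exp_neg {a : ℝ} (ha : 0 < a) (x : ℝ) :
    IntervalIntegrable (fun t : ℝ => t ^ (a - 1) * Real.exp (-t)) volume 0 x :=
  (intervalIntegral.intervalIntegrable_rpow' (by linarith)).mul_continuousOn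
    (Real.continuous_exp.comp continuous_neg).continuousOn

theorem lowerGamma_le {a x : ℝ} (ha : 0 < a) (hx : 0 ≤ x) : lowerGamma a x ≤ x ^ a / a := by
  rw [← intervalIntegral_rpow_sub_one ha]
  refine intervalIntegral.integral_mono_on hx (intervalIntegrable_rpow_mul_exp_neg ha x)
    (intervalIntegral.intervalIntegrable_rpow' (by linarith)) fun t ht => ?_
  exact mul_le_of_le_one_right (Real.rpow_nonneg ht.1 _)
    (Real.exp_le_one_iff.2 (neg_nonpos.2 ht.1))

theorem exp_neg_mul_le_lowerGamma {a x : ℝ} (ha : 0 < a) (hx : 0 ≤ x) :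
    Real.exp (-x) * (x ^ a / a) ≤ lowerGamma a x := by
  rw [← intervalIntegral_rpow_sub_one ha, mul_comm, ← intervalIntegral.integral_mul_const]
  refine intervalIntegral.integral_mono_on hx
    ((intervalIntegral.intervalIntegrable_rpow' (by linarith)).mul_const _)
    (intervalIntegrable_rpow_mul_exp_neg ha x) fun t ht => ?_
  exact mul_le_mul_of_nonneg_left (Real.exp_le_exp.2 (neg_le_neg ht.2))
    (Real.rpow_nonneg ht.1 _)

theorem tendsto_lowerGamma_div_rpow {a : ℝ} (ha : 0 < a) :
    Tendsto (fun x => lowerGamma a x / x ^ a) (nhdsWithin 0 (Set.Ioi 0)) (nhds (1 / a)) := by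
  have hexp : Tendsto (fun x : ℝ => Real.exp (-x) * (1 / a)) (nhdsWithin 0 (Set.Ioi 0))
      (nhds (1 / a)) := by
    have h : Continuous fun x : ℝ => Real.exp (-x) * (1 / a) := by fun_prop
    simpa using (h.tendsto 0).mono_left nhdsWithin_le_nhds
  refine tendsto_of_tendsto_of_tendsto_of_le_of_le' hexp tendsto_const_nhds ?_ ?_
  · filter_upwards [self_mem_nhdsWithin] with x hx
    rw [le_div_iff₀ (Real.rpow_pos_of_pos hx a)]
    exact le_of_eq_of_le (by ring) (exp_neg_mul_le_lowerGamma ha (le_of_lt hx))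
  · filter_upwards [self_mem_nhdsWithin] with x hx
    rw [div_le_iff₀ (Real.rpow_pos_of_pos hx a)]
    exact (lowerGamma_le ha (le_of_lt hx)).trans_eq (by ring)

theorem tendsto_sqrt_div_atTop {θ : ℝ} (hθ : 0 < θ) :
    Tendsto (fun s : ℝ => Real.sqrt (θ / s)) atTop (nhdsWithin 0 (Set.Ioi 0)) := by
  refine tendsto_nhdsWithin_iff.2 ⟨?_, ?_⟩
  · have h : Tendsto (fun s : ℝ => θ / s) atTop (nhds 0) := tendsto_const_nhds.div_atTop tendsto_id
    simpa using h.sqrt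
  · filter_upwards [eventually_gt_atTop 0] with s hs
    exact Real.sqrt_pos.2 (div_pos hθ hs)

theorem tendsto_rpow_mul_lowerGamma_sqrt {a θ : ℝ} (ha : 0 < a) (hθ : 0 < θ) :
    Tendsto (fun s : ℝ => s ^ (a / 2) * (lowerGamma a (Real.sqrt (θ / s)) / Real.Gamma a))
      atTop (nhds (θ ^ (a / 2) / Real.Gamma (a + 1))) := by
  have h := ((tendsto_lowerGamma_div_rpow ha).comp (tendsto_sqrt_div_atTop hθ)).const_mul
    (θ ^ (a / 2) / Real.Gamma a)
  rw [Real.Gamma_add_one ha.ne']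
  convert h.congr' ?_ using 2
  · have := (Real.Gamma_pos_of_pos ha).ne'
    field_simp
  · filter_upwards [eventually_gt_atTop 0] with s hs
    have hsqrt : Real.sqrt (θ / s) ^ a = θ ^ (a / 2) / s ^ (a / 2) := by
      rw [Real.sqrt_eq_rpow, ← Real.rpow_mul (div_pos hθ hs).le, ← Real.div_rpow hθ.le hs.le]
      congr 1
      ring
    have hs' := (Real.rpow_pos_of_pos hs (a / 2)).ne'
    have hθ' := (Real.rpow_pos_of_pos hθ (a / 2)).ne'
    have hΓ := (Real.Gamma_pos_of_pos ha).ne'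
    simp only [Function.comp_apply, hsqrt]
    field_simp

/-- For `a_k, θ_k > 0` and `A = Σ_k a_k`,
`lim_{s → ∞} s^(A/2) ∏_k γ(a_k, √(θ_k/s))/Γ(a_k) = ∏_k θ_k^(a_k/2)/Γ(a_k + 1)`. -/
theorem asymptotic_outage (K : ℕ) (hK : 0 < K) (a θ : Fin K → ℝ)
    (ha : ∀ k, 0 < a k) (hθ : ∀ k, 0 < θ k) :
    Tendsto
      (fun s : ℝ => s ^ ((∑ k, a k) / 2) *
        ∏ k, lowerGamma (a k) (Real.sqrt (θ k / s)) / Real.Gamma (a k))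
      atTop (nhds (∏ k, θ k ^ (a k / 2) / Real.Gamma (a k + 1))) := by
  refine (tendsto_finsetProd Finset.univ fun k _ =>
    tendsto_rpow_mul_lowerGamma_sqrt (ha k) (hθ k)).congr' ?_
  filter_upwards [eventually_gt_atTop 0] with s hs
  rw [Finset.prod_mul_distrib, Finset.sum_div, Real.rpow_sum_of_pos hs]
end

section
/- Let X be a nonnegative real random variable with cumulative distribution function F, let q > 0 and p > 0, and let Q(x) = (1/√(2π)) ∫_x^∞ exp(−u²/2) du be the Gaussian Q-function. Then E[ p Q(√(2 q X)) ] = (p √q / (2 √π)) ∫₀^∞ exp(−q t) t^{−1/2} F(t) dt. -/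
open MeasureTheory Real

/-- The Gaussian Q-function `Q(x) = (1/√(2π)) ∫_x^∞ exp(−u²/2) du`. -/
noncomputable def gaussQ (x : ℝ) : ℝ :=
  (1 / Real.sqrt (2 * Real.pi)) * ∫ u in Set.Ioi x, Real.exp (-u ^ 2 / 2)

/-- Change of variables `u = √(2qt)` in the Gaussian tail integral. -/
theorem gaussQ_sqrt_eq_integral {q x : ℝ} (hq : 0 < q) (hx : 0 ≤ x) :
    gaussQ (Real.sqrt (2 * q * x)) = Real.sqrt q / (2 * Real.sqrt Real.pi) *
      ∫ t in Set.Ioi x, Real.exp (-(q * t)) * t ^ (-(1 : ℝ) / 2) := by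
  have himage : (fun t : ℝ => Real.sqrt (2 * q * t)) '' Set.Ioi x =
      Set.Ioi (Real.sqrt (2 * q * x)) := by
    ext u
    constructor
    · rintro ⟨t, ht, rfl⟩
      exact Real.sqrt_lt_sqrt (by positivity) (mul_lt_mul_of_pos_left ht (by positivity))
    · intro hu
      have hu0 : 0 < u := (Real.sqrt_nonneg _).trans_lt hu
      refine ⟨u ^ 2 / (2 * q), ?_, ?_⟩
      · rw [Set.mem_Ioi, lt_div_iff₀ (by positivity), mul_comm]
        exact (Real.sqrt_lt' hu0).1 hu
      · dsimp only
        rw [mul_div_cancel₀ _ (by positivity), Real.sqrt_sq hu0.le]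
  have hinj : Set.InjOn (fun t : ℝ => Real.sqrt (2 * q * t)) (Set.Ioi x) := by
    intro s hs t ht hst
    have hs0 : 0 ≤ s := hx.trans (le_of_lt hs)
    have ht0 : 0 ≤ t := hx.trans (le_of_lt ht)
    exact mul_left_cancel₀ (by positivity : 2 * q ≠ 0)
      ((Real.sqrt_inj (by positivity) (by positivity)).1 hst)
  have hderiv : ∀ t ∈ Set.Ioi x, HasDerivWithinAt (fun t : ℝ => Real.sqrt (2 * q * t))
      (2 * q / (2 * Real.sqrt (2 * q * t))) (Set.Ioi x) t := by
    intro t ht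
    have ht0 : 0 < t := hx.trans_lt ht
    have h := ((hasDerivAt_id t).const_mul (2 * q)).sqrt (mul_pos (by positivity) ht0).ne'
    simpa using h.hasDerivWithinAt
  rw [gaussQ, ← himage,
    integral_image_eq_integral_abs_deriv_smul measurableSet_Ioi hderiv hinj,
    ← integral_const_mul, ← integral_const_mul]
  refine setIntegral_congr_fun measurableSet_Ioi fun t ht => ?_
  have ht0 : 0 < t := hx.trans_lt ht
  have hexp : -Real.sqrt (2 * q * t) ^ 2 / 2 = -(q * t) := by
    rw [Real.sq_sqrt (by positivity)]
    ring
  have hrpow : t ^ (-(1 : ℝ) / 2) = (Real.sqrt t)⁻¹ := by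
    rw [neg_div, Real.rpow_neg ht0.le, ← Real.sqrt_eq_rpow]
  simp only [smul_eq_mul]
  rw [hexp, hrpow, abs_of_nonneg (by positivity), Real.sqrt_mul (by positivity),
    Real.sqrt_mul (by positivity), Real.sqrt_mul (by positivity)]
  have h2 : Real.sqrt 2 ^ 2 = 2 := Real.sq_sqrt (by positivity)
  have hq2 : Real.sqrt q ^ 2 = q := Real.sq_sqrt hq.le
  field_simp
  rw [h2, hq2]

theorem integrableOn_exp_neg_mul_rpow_neg_half {q : ℝ} (hq : 0 < q) :
    IntegrableOn (fun t : ℝ => Real.exp (-(q * t)) * t ^ (-(1 : ℝ) / 2)) (Set.Ioi 0) := by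
  have h := integrableOn_rpow_mul_exp_neg_mul_rpow (s := -(1 : ℝ) / 2) (p := 1) (b := q)
    (by norm_num) (by norm_num) hq
  simpa [mul_comm] using h

/-- Integrating the tail integrals of `g` from a nonnegative random variable gives the integral of
`g` against its distribution function. -/
theorem integral_integral_Ioi_eq_integral_mul_measureReal_le {α : Type*} [MeasurableSpace α]
    (μ : Measure α) [IsFiniteMeasure μ] {X : α → ℝ} (hX : Measurable X) (hX0 : ∀ ω, 0 ≤ X ω)
    {g : ℝ → ℝ} (hg : IntegrableOn g (Set.Ioi 0)) :
    ∫ ω, (∫ t in Set.Ioi (X ω), g t) ∂μ = ∫ t in Set.Ioi 0, g t * μ.real {ω | X ω ≤ t} := by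
  have hS : MeasurableSet {z : α × ℝ | X z.1 ≤ z.2} :=
    measurableSet_le (hX.comp measurable_fst) measurable_snd
  have hint : Integrable ({z : α × ℝ | X z.1 ≤ z.2}.indicator fun z => g z.2)
      (μ.prod (volume.restrict (Set.Ioi 0))) :=
    (Integrable.comp_snd (hg : Integrable g (volume.restrict (Set.Ioi 0))) μ).indicator hS
  have hleft : ∀ ω, ∫ t in Set.Ioi (X ω), g t =
      ∫ t in Set.Ioi 0, {z : α × ℝ | X z.1 ≤ z.2}.indicator (fun z => g z.2) (ω, t) := by
    intro ω
    have h : (fun t => {z : α × ℝ | X z.1 ≤ z.2}.indicator (fun z => g z.2) (ω, t)) =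
        (Set.Ici (X ω)).indicator g := rfl
    rw [h, setIntegral_indicator measurableSet_Ici,
      setIntegral_congr_set ((Filter.EventuallyEq.refl _ (Set.Ioi 0)).inter Ioi_ae_eq_Ici.symm),
      Set.Ioi_inter_Ioi, sup_eq_right.2 (hX0 ω)]
  have hright : ∀ t,
      ∫ ω, {z : α × ℝ | X z.1 ≤ z.2}.indicator (fun z => g z.2) (ω, t) ∂μ =
        g t * μ.real {ω | X ω ≤ t} := by
    intro t
    have h : (fun ω => {z : α × ℝ | X z.1 ≤ z.2}.indicator (fun z => g z.2) (ω, t)) =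
        {ω | X ω ≤ t}.indicator fun _ => g t := rfl
    rw [h, integral_indicator_const _ (measurableSet_le hX measurable_const), smul_eq_mul,
      mul_comm]
  simp_rw [hleft, ← hright]
  exact integral_integral_swap hint

/-- For a nonnegative random variable `X` with CDF `F`,
`E[p Q(√(2qX))] = (p√q/(2√π)) ∫₀^∞ exp(−qt) t^(−1/2) F(t) dt`. -/
theorem asep_cdf_integral {α : Type*} [MeasurableSpace α] (μ : Measure α)
    [IsProbabilityMeasure μ]
    (X : α → ℝ) (hX : Measurable X) (hXnonneg : ∀ ω, 0 ≤ X ω)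
    (F : ℝ → ℝ) (hF : ∀ t : ℝ, F t = (μ {ω | X ω ≤ t}).toReal)
    (p q : ℝ) (hp : 0 < p) (hq : 0 < q) :
    ∫ ω, p * gaussQ (Real.sqrt (2 * q * X ω)) ∂μ =
      p * Real.sqrt q / (2 * Real.sqrt Real.pi) *
        ∫ t in Set.Ioi (0 : ℝ), Real.exp (-(q * t)) * t ^ (-(1 : ℝ) / 2) * F t := by
  simp_rw [hF, gaussQ_sqrt_eq_integral hq (hXnonneg _)]
  rw [integral_const_mul, integral_const_mul,
    integral_integral_Ioi_eq_integral_mul_measureReal_le μ hX hXnonneg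
      (integrableOn_exp_neg_mul_rpow_neg_half hq)]
  simp only [Measure.real]
  ring
end
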